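/- Under the bounded-density assumption on δ, if Ê_{N_ℓ}(Y) and Ê_{N_{ℓ-1}}(Y) are Monte Carlo averages of N_ℓ and N_{ℓ-1} samples respectively (with N_{ℓ-1} ≤ N_ℓ), conditionally i.i.d. given the same Y, then Var(H(Ê_{N_ℓ}(Y)) − H(Ê_{N_{ℓ-1}}(Y))) ≤ 2(2ρ₀·N_ℓ^{-1/2} + δ₀^{-2}·N_ℓ^{-1}) + 2(2ρ₀·N_{ℓ-1}^{-1/2} + δ₀^{-2}·N_{ℓ-1}^{-1}); in particular this variance is O(N_{ℓ-1}^{-1/2}). -/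

import Mathlib

open MeasureTheory ProbabilityTheory
open scoped ENNReal

/-- The Heaviside step function: `H(x) = 1` for `x ≥ 0` and `0` otherwise. -/
noncomputable def heaviside (x : ℝ) : ℝ := if 0 ≤ x then 1 else 0

/-- The integral over the half-line of `min 1 (a² / t²)` is at most `2a`. -/
lemma lintegral_Ioi_min_one_sq_div_sq_le {a : ℝ} (ha : 0 < a) :
    ∫⁻ t in Set.Ioi (0 : ℝ), min 1 (ENNReal.ofReal (a ^ 2 / t ^ 2)) ≤ ENNReal.ofReal (2 * a) := by
  have hnear : ∫⁻ t in Set.Ioc 0 a, min 1 (ENNReal.ofReal (a ^ 2 / t ^ 2)) ≤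
      ENNReal.ofReal a := by
    calc ∫⁻ t in Set.Ioc 0 a, min 1 (ENNReal.ofReal (a ^ 2 / t ^ 2))
        ≤ ∫⁻ _ in Set.Ioc 0 a, 1 := lintegral_mono fun _ => min_le_left _ _
      _ = ENNReal.ofReal a := by simp
  have hfar : ∫⁻ t in Set.Ioi a, min 1 (ENNReal.ofReal (a ^ 2 / t ^ 2)) ≤ ENNReal.ofReal a := by
    calc ∫⁻ t in Set.Ioi a, min 1 (ENNReal.ofReal (a ^ 2 / t ^ 2))
        ≤ ∫⁻ t in Set.Ioi a, ENNReal.ofReal (a ^ 2 * t ^ (-2 : ℝ)) := by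
          refine setLIntegral_mono' measurableSet_Ioi fun t ht => (min_le_right _ _).trans ?_
          rw [Real.rpow_neg (ha.trans ht).le, Real.rpow_two, div_eq_mul_inv]
      _ = ENNReal.ofReal (∫ t in Set.Ioi a, a ^ 2 * t ^ (-2 : ℝ)) := by
          rw [ofReal_integral_eq_lintegral_ofReal]
          · exact (integrableOn_Ioi_rpow_of_lt (by norm_num) ha).const_mul _
          · filter_upwards [ae_restrict_mem measurableSet_Ioi] with t ht
            have : 0 < t := ha.trans ht
            simp only [Pi.zero_apply]
            positivity
      _ = ENNReal.ofReal a := by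
          rw [integral_const_mul, integral_Ioi_rpow_of_lt (by norm_num) ha]
          congr 1
          norm_num [Real.rpow_neg_one]
          field_simp
  rw [← Set.Ioc_union_Ioi_eq_Ioi ha.le,
    lintegral_union measurableSet_Ioi (Set.Ioc_disjoint_Ioi le_rfl), two_mul,
    ENNReal.ofReal_add ha.le ha.le]
  exact add_le_add hnear hfar

/-- If a probability law on `[0, ∞)` has a density bounded by `ρ₀` on `[0, δ₀]`, then the
expectation of `min 1 (a² / t²)` is at most `2ρ₀a + a² / δ₀²`. -/
lemma lintegral_min_one_sq_div_sq_le_of_density_le (P : Measure ℝ) [IsProbabilityMeasure P]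
    (hP : ∀ᵐ t ∂P, 0 ≤ t) {ρ : ℝ → ℝ} {ρ₀ δ₀ : ℝ} (hρ₀ : 0 ≤ ρ₀) (hδ₀ : 0 < δ₀)
    (hdensity : P = volume.withDensity fun t => ENNReal.ofReal (ρ t))
    (hρbound : ∀ t ∈ Set.Icc (0 : ℝ) δ₀, ρ t ≤ ρ₀) {a : ℝ} (ha : 0 < a) :
    ∫⁻ t, min 1 (ENNReal.ofReal (a ^ 2 / t ^ 2)) ∂P ≤
      ENNReal.ofReal (2 * ρ₀ * a + a ^ 2 / δ₀ ^ 2) := by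
  have hrestrict : P.restrict (Set.Icc 0 δ₀) ≤
      ENNReal.ofReal ρ₀ • volume.restrict (Set.Icc 0 δ₀) := by
    rw [hdensity, restrict_withDensity measurableSet_Icc, ← withDensity_const]
    refine withDensity_mono ?_
    filter_upwards [ae_restrict_mem measurableSet_Icc] with t ht
    exact ENNReal.ofReal_le_ofReal (hρbound t ht)
  have hnear : ∫⁻ t in Set.Icc 0 δ₀, min 1 (ENNReal.ofReal (a ^ 2 / t ^ 2)) ∂P ≤
      ENNReal.ofReal (2 * ρ₀ * a) := by
    calc ∫⁻ t in Set.Icc 0 δ₀, min 1 (ENNReal.ofReal (a ^ 2 / t ^ 2)) ∂P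
        ≤ ∫⁻ t, min 1 (ENNReal.ofReal (a ^ 2 / t ^ 2))
            ∂(ENNReal.ofReal ρ₀ • volume.restrict (Set.Icc 0 δ₀)) :=
          lintegral_mono' hrestrict le_rfl
      _ = ENNReal.ofReal ρ₀ *
            ∫⁻ t in Set.Icc 0 δ₀, min 1 (ENNReal.ofReal (a ^ 2 / t ^ 2)) := by
          rw [lintegral_smul_measure, smul_eq_mul]
      _ ≤ ENNReal.ofReal ρ₀ * ENNReal.ofReal (2 * a) := by
          gcongr
          rw [setLIntegral_congr Ioc_ae_eq_Icc.symm]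
          exact (lintegral_mono_set Set.Ioc_subset_Ioi_self).trans
            (lintegral_Ioi_min_one_sq_div_sq_le ha)
      _ = ENNReal.ofReal (2 * ρ₀ * a) := by
          rw [← ENNReal.ofReal_mul hρ₀]
          congr 1
          ring
  have hfar : ∫⁻ t in (Set.Icc 0 δ₀)ᶜ, min 1 (ENNReal.ofReal (a ^ 2 / t ^ 2)) ∂P ≤
      ENNReal.ofReal (a ^ 2 / δ₀ ^ 2) := by
    calc ∫⁻ t in (Set.Icc 0 δ₀)ᶜ, min 1 (ENNReal.ofReal (a ^ 2 / t ^ 2)) ∂P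
        ≤ ∫⁻ _ in (Set.Icc 0 δ₀)ᶜ, ENNReal.ofReal (a ^ 2 / δ₀ ^ 2) ∂P := by
          refine lintegral_mono_ae ?_
          filter_upwards [ae_restrict_mem measurableSet_Icc.compl, ae_restrict_of_ae hP]
            with t ht ht0
          have hlt : δ₀ < t := by
            by_contra! h
            exact ht ⟨ht0, h⟩
          refine (min_le_right _ _).trans (ENNReal.ofReal_le_ofReal ?_)
          gcongr
      _ ≤ ENNReal.ofReal (a ^ 2 / δ₀ ^ 2) := by
          rw [setLIntegral_const]
          exact mul_le_of_le_one_right' prob_le_one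
  rw [← lintegral_add_compl _ (measurableSet_Icc (a := (0 : ℝ)) (b := δ₀)),
    ENNReal.ofReal_add (by positivity) (by positivity)]
  exact add_le_add hnear hfar

/-- Chebyshev's inequality for the average of `N` independent samples of a law `μ`, at a
distance from the mean equal to the modulus of the mean. -/
lemma pi_abs_integral_le_abs_average_sub_le (μ : Measure ℝ) [IsProbabilityMeasure μ]
    (hμ2 : Integrable (fun x => x ^ 2) μ) (hmean : ∫ t, t ∂μ ≠ 0) {N : ℕ} (hN : 1 ≤ N) :
    (Measure.pi fun _ : Fin N => μ)
        {x | |∫ t, t ∂μ| ≤ |(∑ n, x n) / (N : ℝ) - ∫ t, t ∂μ|} ≤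
      ENNReal.ofReal (variance (fun t => t) μ / N / (∫ t, t ∂μ) ^ 2) := by
  have hN0 : (N : ℝ) ≠ 0 := by positivity
  have hid : MemLp (fun t : ℝ => t) 2 μ :=
    (memLp_two_iff_integrable_sq measurable_id.aestronglyMeasurable).2 hμ2
  have heval (i : Fin N) : MemLp (fun x : Fin N → ℝ => x i) 2 (Measure.pi fun _ => μ) :=
    hid.comp_measurePreserving (measurePreserving_eval (fun _ : Fin N => μ) i)
  have hsum : MemLp (fun x : Fin N → ℝ => ∑ n, x n) 2 (Measure.pi fun _ => μ) :=
    memLp_finsetSum _ fun i _ => heval i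
  have havg : MemLp (fun x : Fin N → ℝ => (∑ n, x n) / (N : ℝ)) 2 (Measure.pi fun _ => μ) := by
    simpa only [div_eq_mul_inv] using hsum.mul_const (N : ℝ)⁻¹
  have hexp : ∫ x : Fin N → ℝ, (∑ n, x n) / (N : ℝ) ∂(Measure.pi fun _ => μ) = ∫ t, t ∂μ := by
    rw [integral_div, integral_finsetSum _ fun i _ => (heval i).integrable (by norm_num)]
    have (i : Fin N) : ∫ x : Fin N → ℝ, x i ∂(Measure.pi fun _ => μ) = ∫ t, t ∂μ :=
      integral_comp_eval (μ := fun _ : Fin N => μ) (f := fun t : ℝ => t) hid.1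
    simp only [this, Finset.sum_const, Finset.card_univ, Fintype.card_fin, nsmul_eq_mul]
    field_simp
  have hvar : variance (fun x : Fin N → ℝ => (∑ n, x n) / (N : ℝ)) (Measure.pi fun _ => μ) =
      variance (fun t => t) μ / N := by
    have h := variance_sum_pi (μ := fun _ : Fin N => μ) (X := fun _ t => t) fun _ => hid
    have hfun : (∑ i : Fin N, fun x : Fin N → ℝ => x i) = fun x => ∑ n, x n := by
      ext x
      simp
    rw [hfun] at h
    simp only [div_eq_mul_inv]
    rw [variance_mul_const, h]
    simp only [Finset.sum_const, Finset.card_univ, Fintype.card_fin, nsmul_eq_mul]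
    field_simp
  have h := meas_ge_le_variance_div_sq havg (abs_pos.2 hmean)
  rwa [hexp, hvar, sq_abs] at h

/-- The probability that a conditional Monte Carlo average misses the conditional mean by at
least the modulus of the mean, when the normalised mean `δ` has a density bounded near zero. -/
lemma compProd_abs_mean_le_abs_average_sub_le {𝓨 Ω : Type*} [MeasurableSpace 𝓨]
    [MeasurableSpace Ω] (ν : Measure 𝓨) [IsProbabilityMeasure ν]
    (μ : 𝓨 → Measure ℝ) (hprob : ∀ y, IsProbabilityMeasure (μ y))
    (hμ2 : ∀ y, Integrable (fun x => x ^ 2) (μ y))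
    (m δ : 𝓨 → ℝ) (hm : ∀ y, m y = ∫ t, t ∂μ y)
    (hδ : ∀ y, δ y = |m y| / Real.sqrt (variance (fun t => t) (μ y)))
    (hmmeas : Measurable m) (hδmeas : Measurable δ)
    (ρ : ℝ → ℝ) (ρ₀ δ₀ : ℝ) (hρ₀ : 0 < ρ₀) (hδ₀ : 0 < δ₀)
    (hdensity : ν.map δ = volume.withDensity fun t => ENNReal.ofReal (ρ t))
    (hρbound : ∀ t ∈ Set.Icc (0 : ℝ) δ₀, ρ t ≤ ρ₀)
    {N : ℕ} (hN : 1 ≤ N) (κ : Kernel 𝓨 Ω) [IsMarkovKernel κ]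
    (X : Ω → Fin N → ℝ) (hX : Measurable X)
    (hκ : ∀ y, (κ y).map X = Measure.pi fun _ : Fin N => μ y) :
    (ν ⊗ₘ κ) {p | |m p.1| ≤ |(∑ n, X p.2 n) / (N : ℝ) - m p.1|} ≤
      ENNReal.ofReal (2 * ρ₀ * (N : ℝ) ^ (-(1 : ℝ) / 2) + δ₀ ^ (-(2 : ℝ)) * (N : ℝ)⁻¹) := by
  have hNpos : (0 : ℝ) < N := by positivity
  set a : ℝ := (N : ℝ) ^ (-(1 : ℝ) / 2) with ha_def
  have ha : 0 < a := by positivity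
  have ha2 : a ^ 2 = (N : ℝ)⁻¹ := by
    rw [ha_def, ← Real.rpow_natCast, ← Real.rpow_mul hNpos.le]
    norm_num [Real.rpow_neg_one]
  have hδne : ∀ᵐ y ∂ν, δ y ≠ 0 := by
    have hac : ν.map δ ≪ volume := hdensity ▸ withDensity_absolutelyContinuous _ _
    exact ae_of_ae_map hδmeas.aemeasurable (hac.ae_le (Measure.ae_ne volume 0))
  have hP : IsProbabilityMeasure (ν.map δ) := Measure.isProbabilityMeasure_map hδmeas.aemeasurable
  have hδnonneg : ∀ᵐ t ∂(ν.map δ), 0 ≤ t := by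
    rw [ae_map_iff hδmeas.aemeasurable measurableSet_Ici]
    filter_upwards with y
    rw [hδ]
    positivity
  have hmeas : MeasurableSet
      {p : 𝓨 × Ω | |m p.1| ≤ |(∑ n, X p.2 n) / (N : ℝ) - m p.1|} :=
    measurableSet_le (by fun_prop) (by fun_prop)
  rw [Measure.compProd_apply hmeas]
  calc ∫⁻ y, κ y (Prod.mk y ⁻¹' {p | |m p.1| ≤ |(∑ n, X p.2 n) / (N : ℝ) - m p.1|}) ∂ν
      ≤ ∫⁻ y, min 1 (ENNReal.ofReal (a ^ 2 / δ y ^ 2)) ∂ν := by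
        refine lintegral_mono_ae ?_
        filter_upwards [hδne] with y hy
        have := hprob y
        refine le_min prob_le_one ?_
        have hmy : ∫ t, t ∂μ y ≠ 0 := fun h => hy (by rw [hδ, hm, h]; simp)
        have hcheb := pi_abs_integral_le_abs_average_sub_le (μ y) (hμ2 y) hmy hN
        rw [← hκ, Measure.map_apply hX (measurableSet_le (by fun_prop) (by fun_prop)),
          ← hm] at hcheb
        refine hcheb.trans_eq ?_
        rw [ha2, hδ, div_pow, Real.sq_sqrt (variance_nonneg _ _), sq_abs]
        congr 1
        simp only [div_eq_mul_inv, mul_inv, inv_inv]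
        ring
    _ = ∫⁻ t, min 1 (ENNReal.ofReal (a ^ 2 / t ^ 2)) ∂(ν.map δ) := by
        rw [lintegral_map (by fun_prop) hδmeas]
    _ ≤ ENNReal.ofReal (2 * ρ₀ * a + a ^ 2 / δ₀ ^ 2) :=
        lintegral_min_one_sq_div_sq_le_of_density_le _ hδnonneg hρ₀.le hδ₀ hdensity hρbound ha
    _ = ENNReal.ofReal (2 * ρ₀ * a + δ₀ ^ (-(2 : ℝ)) * (N : ℝ)⁻¹) := by
        rw [ha2, Real.rpow_neg hδ₀.le, Real.rpow_two]
        congr 2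
        ring

lemma measurable_heaviside : Measurable heaviside :=
  Measurable.ite measurableSet_Ici measurable_const measurable_const

/-- An approximation closer to `c` than `|c|` has the sign of `c`. -/
lemma heaviside_eq_of_abs_sub_lt_abs {b c : ℝ} (h : |b - c| < |c|) :
    heaviside b = heaviside c := by
  unfold heaviside
  grind

lemma sq_heaviside_sub_heaviside_le_one (b c : ℝ) : (heaviside b - heaviside c) ^ 2 ≤ 1 := by
  unfold heaviside
  split_ifs <;> norm_num

/-- Variance of a MLMC level difference with deterministic inner
sampling: under the bounded-density assumption on `δ = d/σ`, if `Ê_{N_ℓ}(Y)` and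
`Ê_{N_{ℓ-1}}(Y)` are Monte Carlo averages of `N_ℓ ≥ N_{ℓ-1}` conditionally i.i.d. and
mutually conditionally independent samples given the same `Y`, then
`Var(H(Ê_{N_ℓ}(Y)) − H(Ê_{N_{ℓ-1}}(Y)))
  ≤ 2(2ρ₀·N_ℓ^{-1/2} + δ₀^{-2}·N_ℓ^{-1}) + 2(2ρ₀·N_{ℓ-1}^{-1/2} + δ₀^{-2}·N_{ℓ-1}^{-1})`. -/
theorem variance_mlmc_level_difference {𝓨 : Type*} [MeasurableSpace 𝓨]
    (ν : Measure 𝓨) [IsProbabilityMeasure ν]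
    (μ : 𝓨 → Measure ℝ) (hprob : ∀ y, IsProbabilityMeasure (μ y))
    (hμ2 : ∀ y, Integrable (fun x => x ^ 2) (μ y))
    (m s δ : 𝓨 → ℝ)
    (hm : ∀ y, m y = ∫ t, t ∂μ y)
    (hs : ∀ y, s y = Real.sqrt (variance (fun t => t) (μ y)))
    (hδ : ∀ y, δ y = |m y| / s y)
    (hmmeas : Measurable m) (hδmeas : Measurable δ)
    (ρ : ℝ → ℝ) (ρ₀ δ₀ : ℝ) (hρ₀ : 0 < ρ₀) (hδ₀ : 0 < δ₀)
    (hdensity : ν.map δ = MeasureTheory.volume.withDensity fun t => ENNReal.ofReal (ρ t))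
    (hρbound : ∀ t ∈ Set.Icc (0 : ℝ) δ₀, ρ t ≤ ρ₀)
    (Nf Nc : ℕ) (hNc : 1 ≤ Nc) (hNcf : Nc ≤ Nf)
    (κ : Kernel 𝓨 ((Fin Nf → ℝ) × (Fin Nc → ℝ))) [IsMarkovKernel κ]
    (hκ : ∀ y, κ y = (Measure.pi fun _ : Fin Nf => μ y).prod
                        (Measure.pi fun _ : Fin Nc => μ y)) :
    variance
        (fun p : 𝓨 × ((Fin Nf → ℝ) × (Fin Nc → ℝ)) =>
          heaviside ((∑ n, p.2.1 n) / (Nf : ℝ)) - heaviside ((∑ n, p.2.2 n) / (Nc : ℝ)))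
        (ν ⊗ₘ κ)
      ≤ 2 * (2 * ρ₀ * (Nf : ℝ) ^ (-(1 : ℝ) / 2) + δ₀ ^ (-(2 : ℝ)) * (Nf : ℝ)⁻¹)
        + 2 * (2 * ρ₀ * (Nc : ℝ) ^ (-(1 : ℝ) / 2) + δ₀ ^ (-(2 : ℝ)) * (Nc : ℝ)⁻¹) := by
  set F : Set (𝓨 × ((Fin Nf → ℝ) × (Fin Nc → ℝ))) :=
    {p | |m p.1| ≤ |(∑ n, p.2.1 n) / (Nf : ℝ) - m p.1|}
  set C : Set (𝓨 × ((Fin Nf → ℝ) × (Fin Nc → ℝ))) :=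
    {p | |m p.1| ≤ |(∑ n, p.2.2 n) / (Nc : ℝ) - m p.1|}
  set D : 𝓨 × ((Fin Nf → ℝ) × (Fin Nc → ℝ)) → ℝ := fun p =>
    heaviside ((∑ n, p.2.1 n) / (Nf : ℝ)) - heaviside ((∑ n, p.2.2 n) / (Nc : ℝ))
  set bf : ℝ := 2 * ρ₀ * (Nf : ℝ) ^ (-(1 : ℝ) / 2) + δ₀ ^ (-(2 : ℝ)) * (Nf : ℝ)⁻¹
  set bc : ℝ := 2 * ρ₀ * (Nc : ℝ) ^ (-(1 : ℝ) / 2) + δ₀ ^ (-(2 : ℝ)) * (Nc : ℝ)⁻¹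
  have hbf0 : 0 ≤ bf := by positivity
  have hbc0 : 0 ≤ bc := by positivity
  have hδ' : ∀ y, δ y = |m y| / Real.sqrt (variance (fun t => t) (μ y)) := fun y => by
    rw [hδ, hs]
  have hF : (ν ⊗ₘ κ) F ≤ ENNReal.ofReal bf :=
    compProd_abs_mean_le_abs_average_sub_le ν μ hprob hμ2 m δ hm hδ' hmmeas hδmeas ρ ρ₀ δ₀
      hρ₀ hδ₀ hdensity hρbound (hNc.trans hNcf) κ Prod.fst measurable_fst
      fun y => by rw [hκ, Measure.map_fst_prod, measure_univ, one_smul]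
  have hC : (ν ⊗ₘ κ) C ≤ ENNReal.ofReal bc :=
    compProd_abs_mean_le_abs_average_sub_le ν μ hprob hμ2 m δ hm hδ' hmmeas hδmeas ρ ρ₀ δ₀
      hρ₀ hδ₀ hdensity hρbound hNc κ Prod.snd measurable_snd
      fun y => by rw [hκ, Measure.map_snd_prod, measure_univ, one_smul]
  have hD : Measurable D :=
    (measurable_heaviside.comp (by fun_prop)).sub (measurable_heaviside.comp (by fun_prop))
  have hsub : ∀ p, ENNReal.ofReal ((D ^ 2) p) ≤ (F ∪ C).indicator 1 p := fun p => by
    by_cases hp : p ∈ F ∪ C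
    · rw [Set.indicator_of_mem hp]
      exact ENNReal.ofReal_le_one.2 (sq_heaviside_sub_heaviside_le_one _ _)
    · have hpF : ¬ |m p.1| ≤ |(∑ n, p.2.1 n) / (Nf : ℝ) - m p.1| := fun h => hp (Or.inl h)
      have hpC : ¬ |m p.1| ≤ |(∑ n, p.2.2 n) / (Nc : ℝ) - m p.1| := fun h => hp (Or.inr h)
      have hDp : D p = 0 := by
        simp only [D]
        rw [heaviside_eq_of_abs_sub_lt_abs (not_le.1 hpF),
          heaviside_eq_of_abs_sub_lt_abs (not_le.1 hpC), sub_self]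
      simp [hDp]
  have hlint : ∫⁻ p, ENNReal.ofReal ((D ^ 2) p) ∂(ν ⊗ₘ κ) ≤ ENNReal.ofReal (bf + bc) :=
    calc ∫⁻ p, ENNReal.ofReal ((D ^ 2) p) ∂(ν ⊗ₘ κ)
        ≤ ∫⁻ p, (F ∪ C).indicator 1 p ∂(ν ⊗ₘ κ) := lintegral_mono hsub
      _ ≤ (ν ⊗ₘ κ) (F ∪ C) := lintegral_indicator_one_le _
      _ ≤ (ν ⊗ₘ κ) F + (ν ⊗ₘ κ) C := measure_union_le _ _
      _ ≤ ENNReal.ofReal (bf + bc) := by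
          rw [ENNReal.ofReal_add hbf0 hbc0]
          exact add_le_add hF hC
  have hvar : variance D (ν ⊗ₘ κ) ≤ bf + bc := by
    refine (variance_le_expectation_sq hD.aestronglyMeasurable).trans ?_
    rw [integral_eq_lintegral_of_nonneg_ae (f := D ^ 2) (ae_of_all _ fun p => sq_nonneg (D p))
      (hD.pow_const 2).aestronglyMeasurable]
    exact ENNReal.toReal_le_of_le_ofReal (by positivity) hlint
  linarith
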